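/- arXiv:2303.05626 — 3 statements merged into one kernel-verified Lean document; each statement's English description precedes it below -/
import Mathlib

section
/- Let Γ be a finite additive abelian group, m ≥ 1, and let χ : Fin m → Γ be injective with χ(i) ≠ 0 for all i. Then: (i) the kernel lattice L(χ) contains no nonzero nonnegative element of degree ≤ 1; and (ii) L(χ) contains m ℤ-linearly independent nonnegative elements, each of degree ≤ 2, if and only if χ(i) + χ(i) = 0 for every i. (This is the lattice form of: γ_field(G,V) = 2 if and only if all the nontrivial characters in V are involutions; otherwise γ_field(G,V) ≥ 3.) -/
/-- The kernel lattice `L(χ) = {a : Fin m → ℤ | ∑ i, a i • χ i = 0}` of a family of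
elements `χ : Fin m → Γ` of an additive abelian group. -/
def latticeOf {m : ℕ} {Γ : Type*} [AddCommGroup Γ] (χ : Fin m → Γ) :
    AddSubgroup (Fin m → ℤ) where
  carrier := {a | ∑ i, a i • χ i = 0}
  zero_mem' := by simp
  add_mem' := by
    intro a b ha hb
    simp only [Set.mem_setOf_eq] at ha hb ⊢
    simp only [Pi.add_apply, add_smul, Finset.sum_add_distrib, ha, hb, add_zero]
  neg_mem' := by
    intro a ha
    simp only [Set.mem_setOf_eq] at ha ⊢
    simp only [Pi.neg_apply, neg_smul, Finset.sum_neg_distrib, ha, neg_zero]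

/-- A nonzero nonnegative integer vector splits off a standard basis vector. -/
theorem exists_eq_single_add_of_nonneg {m : ℕ} {a : Fin m → ℤ} (ha : ∀ i, 0 ≤ a i)
    (h0 : a ≠ 0) :
    ∃ (p : Fin m) (b : Fin m → ℤ), (∀ i, 0 ≤ b i) ∧ a = Pi.single p 1 + b ∧
      ∑ i, a i = 1 + ∑ i, b i := by
  obtain ⟨p, hp⟩ := Function.ne_iff.mp h0
  refine ⟨p, a - Pi.single p 1, fun i ↦ ?_, by simp, by simp⟩
  have hi := ha i
  by_cases h : i = p
  · subst h
    simp only [Pi.zero_apply] at hp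
    simp only [Pi.sub_apply, Pi.single_eq_same]
    omega
  · simpa [h] using hi

/-- A nonnegative integer vector of degree at most `1` is zero or a standard basis vector. -/
theorem eq_zero_or_eq_single_of_sum_le_one {m : ℕ} {a : Fin m → ℤ} (ha : ∀ i, 0 ≤ a i)
    (h1 : ∑ i, a i ≤ 1) : a = 0 ∨ ∃ p, a = Pi.single p 1 := by
  by_cases h0 : a = 0
  · exact Or.inl h0
  obtain ⟨p, b, hb, rfl, hs⟩ := exists_eq_single_add_of_nonneg ha h0
  have hb0 : b = 0 := funext fun i ↦
    (Finset.sum_eq_zero_iff_of_nonneg fun i _ ↦ hb i).mp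
      (le_antisymm (by linarith) (Finset.sum_nonneg fun i _ ↦ hb i)) i (Finset.mem_univ i)
  exact Or.inr ⟨p, by simp [hb0]⟩

theorem mem_latticeOf {m : ℕ} {Γ : Type*} [AddCommGroup Γ] {χ : Fin m → Γ} {a : Fin m → ℤ} :
    a ∈ latticeOf χ ↔ ∑ i, a i • χ i = 0 :=
  Iff.rfl

theorem sum_single_smul {m : ℕ} {M : Type*} [AddCommGroup M] (f : Fin m → M) (p : Fin m)
    (n : ℤ) : ∑ i, (Pi.single p n : Fin m → ℤ) i • f i = n • f p := by
  simp [Pi.single_apply, ite_smul]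

/-- If all `χ i` are nonzero, the kernel lattice has no nonzero nonnegative element of degree
at most `1`. -/
theorem eq_zero_of_mem_latticeOf_of_sum_le_one {m : ℕ} {Γ : Type*} [AddCommGroup Γ]
    {χ : Fin m → Γ} (hχ : ∀ i, χ i ≠ 0) {a : Fin m → ℤ} (hL : a ∈ latticeOf χ)
    (ha : ∀ i, 0 ≤ a i) (h1 : ∑ i, a i ≤ 1) : a = 0 := by
  obtain h | ⟨p, rfl⟩ := eq_zero_or_eq_single_of_sum_le_one ha h1
  · exact h
  · rw [mem_latticeOf, sum_single_smul, one_smul] at hL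
    exact absurd hL (hχ p)

/-- An odd function on `Γ` induces a functional vanishing on the nonnegative elements of degree
at most `2` of the kernel lattice. -/
theorem sum_mul_eq_zero_of_mem_latticeOf {m : ℕ} {Γ : Type*} [AddCommGroup Γ]
    {χ : Fin m → Γ} (hχ : ∀ i, χ i ≠ 0) {F : Γ → ℤ} (hF : ∀ g, F (-g) = -F g)
    {a : Fin m → ℤ} (hL : a ∈ latticeOf χ) (ha : ∀ i, 0 ≤ a i) (h2 : ∑ i, a i ≤ 2) :
    ∑ i, a i * F (χ i) = 0 := by
  by_cases h0 : a = 0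
  · simp [h0]
  obtain ⟨p, b, hb, rfl, hs⟩ := exists_eq_single_add_of_nonneg ha h0
  obtain rfl | ⟨q, rfl⟩ := eq_zero_or_eq_single_of_sum_le_one hb (by linarith)
  · rw [add_zero, mem_latticeOf, sum_single_smul, one_smul] at hL
    exact absurd hL (hχ p)
  · simp only [mem_latticeOf, Pi.add_apply, add_smul, Finset.sum_add_distrib, sum_single_smul,
      one_smul] at hL
    simp only [← smul_eq_mul, Pi.add_apply, add_smul, Finset.sum_add_distrib, sum_single_smul,
      one_smul]
    rw [eq_neg_of_add_eq_zero_left hL, hF, neg_add_cancel]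

/-- A linearly independent family of `m` vectors in `ℤ^m` is killed by no nonzero functional. -/
theorem LinearIndependent.eq_zero_of_forall_sum_mul_eq_zero {m : ℕ} {a : Fin m → Fin m → ℤ}
    (hli : LinearIndependent ℤ a) {w : Fin m → ℤ} (hw : ∀ j, ∑ i, a j i * w i = 0) : w = 0 := by
  by_contra hne
  obtain ⟨v, hv, hv0⟩ := Matrix.exists_vecMul_eq_zero_iff.mpr
    (Matrix.exists_mulVec_eq_zero_iff (M := Matrix.of a).mp ⟨w, hne, funext hw⟩)
  rw [Matrix.vecMul_eq_sum] at hv0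
  exact hv (funext (Fintype.linearIndependent_iff.mp hli v hv0))

/-- Let `Γ` be a finite additive abelian group, `m ≥ 1`, and
`χ : Fin m → Γ` injective with all values nonzero. Then (i) the kernel lattice `L(χ)` contains
no nonzero nonnegative element of degree `≤ 1`; and (ii) `L(χ)` contains `m` linearly
independent nonnegative elements of degree `≤ 2` iff every `χ i` is an involution. -/
theorem stmt_4 (m : ℕ) (hm : 1 ≤ m) (Γ : Type*) [AddCommGroup Γ] [Finite Γ]
    (χ : Fin m → Γ) (hinj : Function.Injective χ) (hχ : ∀ i, χ i ≠ 0) :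
    (∀ a ∈ latticeOf χ, (∀ i, 0 ≤ a i) → ∑ i, a i ≤ 1 → a = 0) ∧
      ((∃ a : Fin m → (Fin m → ℤ), (∀ j, a j ∈ latticeOf χ) ∧ LinearIndependent ℤ a ∧
          (∀ j i, 0 ≤ a j i) ∧ ∀ j, ∑ i, a j i ≤ 2) ↔ ∀ i, χ i + χ i = 0) := by
  classical
  refine ⟨fun a hL ha h1 ↦ eq_zero_of_mem_latticeOf_of_sum_le_one hχ hL ha h1, ?_, fun h ↦ ?_⟩
  · rintro ⟨a, hL, hli, ha, h2⟩ k
    by_contra hk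
    let F : Γ → ℤ := fun g ↦ (if g = χ k then 1 else 0) - (if -g = χ k then 1 else 0)
    have hF : ∀ g, F (-g) = -F g := fun g ↦ by simp [F]
    have hw := congrFun (hli.eq_zero_of_forall_sum_mul_eq_zero (w := fun i ↦ F (χ i)) fun j ↦
      sum_mul_eq_zero_of_mem_latticeOf hχ hF (hL j) (ha j) (h2 j)) k
    have hneg : -χ k ≠ χ k := fun h ↦ hk (neg_eq_iff_add_eq_zero.mp h)
    simp [F, hneg] at hw
  · refine ⟨fun j ↦ Pi.single j 2, fun j ↦ ?_, ?_, fun j i ↦ ?_, fun j ↦ by simp⟩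
    · rw [mem_latticeOf, sum_single_smul, two_smul, h j]
    · refine Fintype.linearIndependent_iff.mpr fun g hg i ↦ ?_
      simpa [Finset.sum_apply, Pi.single_apply] using congrFun hg i
    · exact (Pi.single_nonneg.mpr zero_le_two : (0 : Fin m → ℤ) ≤ Pi.single j 2) i
end

section
/- Let L be a subgroup of ℤ^m of finite index n, and let d ∈ ℕ satisfy d^m < 2n. If a₁, …, a_m ∈ L are ℤ-linearly independent, nonnegative, and of degree ≤ d, then a₁, …, a_m generate L as an additive group. In particular, if L has full-rank degree ≤ d with d^m < 2n, then L is generated in degree ≤ d. (This is the lattice form of: if γ_field(G,V) < (2|G|)^{1/m}, then β_field(G,V) = γ_field(G,V).) -/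
/-- The determinant of an integer matrix with nonnegative entries is bounded in absolute value by
the product of its row sums. -/
theorem abs_det_le_prod_row_sum {ι : Type*} [Fintype ι] [DecidableEq ι] (A : Matrix ι ι ℤ)
    (hA : ∀ i j, 0 ≤ A i j) : |A.det| ≤ ∏ i, ∑ j, A i j := by
  rw [← Matrix.det_transpose, Matrix.det_apply]
  calc |∑ σ : Equiv.Perm ι, Equiv.Perm.sign σ • ∏ i, A i (σ i)|
      ≤ ∑ σ : Equiv.Perm ι, |Equiv.Perm.sign σ • ∏ i, A i (σ i)| :=
        Finset.abs_sum_le_sum_abs _ _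
    _ = ∑ σ : Equiv.Perm ι, ∏ i, A i (σ i) := by
        refine Finset.sum_congr rfl fun σ _ => ?_
        rw [Units.smul_def, smul_eq_mul, abs_mul, Int.isUnit_iff_abs_eq.mp (Units.isUnit _),
          one_mul, abs_of_nonneg (Finset.prod_nonneg fun i _ => hA i _)]
    _ = ∑ f ∈ Finset.univ.map (⟨fun σ : Equiv.Perm ι => (σ : ι → ι), DFunLike.coe_injective⟩ :
          Equiv.Perm ι ↪ (ι → ι)), ∏ i, A i (f i) := by
        rw [Finset.sum_map]; rfl
    _ ≤ ∑ f : ι → ι, ∏ i, A i (f i) :=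
        Finset.sum_le_sum_of_subset_of_nonneg (Finset.subset_univ _)
          fun f _ _ => Finset.prod_nonneg fun i _ => hA i _
    _ = ∏ i, ∑ j, A i j := (Fintype.prod_sum fun i j => A i j).symm

/-- A square matrix over a domain with linearly independent rows has nonzero determinant. -/
theorem det_ne_zero_of_linearIndependent_rows {ι R : Type*} [Fintype ι] [DecidableEq ι]
    [CommRing R] [IsDomain R] {A : Matrix ι ι R} (h : LinearIndependent R A.row) : A.det ≠ 0 := by
  intro h0
  obtain ⟨v, hv, hvA⟩ := Matrix.exists_vecMul_eq_zero_iff.mpr h0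
  refine hv (funext (Fintype.linearIndependent_iff.mp h v ?_))
  rw [← hvA, Matrix.vecMul_eq_sum]
  rfl

/-- The index of the subgroup generated by the linearly independent rows of a square integer
matrix is the absolute value of its determinant. -/
theorem index_closure_rows_eq_natAbs_det {ι : Type*} [Fintype ι] [DecidableEq ι]
    {A : Matrix ι ι ℤ} (h : LinearIndependent ℤ A.row) :
    (AddSubgroup.closure (Set.range A.row)).index = A.det.natAbs := by
  rw [← Submodule.span_int_eq_addSubgroupClosure,
    AddSubgroup.index_eq_natAbs_det (Pi.basisFun ℤ ι) _ (Module.Basis.span h), Pi.basisFun_det_apply]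
  congr 2
  ext i j
  exact congrFun (congrArg Subtype.val (Module.Basis.span_apply h i)) j

/-- Let `L ≤ ℤ^m` have finite index `n`, and let `d ∈ ℕ` satisfy `d^m < 2n`.
If `a 0, …, a (m-1) ∈ L` are `ℤ`-linearly independent, nonnegative, and of degree `≤ d`, then
they generate `L`. In particular, `L` is then generated in degree `≤ d`. -/
theorem stmt_6 (m n d : ℕ) (L : AddSubgroup (Fin m → ℤ)) (hidx : L.index = n) (hn0 : n ≠ 0)
    (hd : d ^ m < 2 * n)
    (a : Fin m → (Fin m → ℤ)) (haL : ∀ j, a j ∈ L) (hind : LinearIndependent ℤ a)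
    (hpos : ∀ j i, 0 ≤ a j i) (hdeg : ∀ j, ∑ i, a j i ≤ (d : ℤ)) :
    AddSubgroup.closure (Set.range a) = L ∧
      AddSubgroup.closure {x | x ∈ L ∧ (∀ i, 0 ≤ x i) ∧ ∑ i, x i ≤ (d : ℤ)} = L := by
  set M := AddSubgroup.closure (Set.range a)
  have hML : M ≤ L := (AddSubgroup.closure_le L).mpr (Set.range_subset_iff.mpr haL)
  have hMidx : M.index = (Matrix.of a).det.natAbs := index_closure_rows_eq_natAbs_det hind
  have hdet0 : (Matrix.of a).det ≠ 0 := det_ne_zero_of_linearIndependent_rows hind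
  have hdet : |(Matrix.of a).det| ≤ (d : ℤ) ^ m := by
    refine (abs_det_le_prod_row_sum (Matrix.of a) hpos).trans ?_
    calc ∏ j, ∑ i, a j i ≤ ∏ _j : Fin m, (d : ℤ) :=
          Finset.prod_le_prod (fun j _ => Finset.sum_nonneg fun i _ => hpos j i)
            fun j _ => hdeg j
      _ = (d : ℤ) ^ m := by simp
  have hMd : M.index ≤ d ^ m := by
    rw [hMidx]
    zify
    exact hdet
  have hM0 : M.index ≠ 0 := by rwa [hMidx, Int.natAbs_ne_zero]
  have hmul : M.relIndex L * n = M.index := hidx ▸ AddSubgroup.relIndex_mul_index hML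
  have hlt : M.relIndex L < 2 := by
    refine lt_of_mul_lt_mul_right ?_ (Nat.zero_le n)
    omega
  have hne : M.relIndex L ≠ 0 := fun h => hM0 (by rw [← hmul, h, zero_mul])
  have hLM : L ≤ M := AddSubgroup.relIndex_eq_one.mp (by omega)
  refine ⟨le_antisymm hML hLM, le_antisymm ((AddSubgroup.closure_le L).mpr fun x hx => hx.1) ?_⟩
  refine hLM.trans (AddSubgroup.closure_mono ?_)
  rintro _ ⟨j, rfl⟩
  exact ⟨haL j, hpos j, hdeg j⟩
end

section
/- Let p be an odd prime and let A₁, A₂ ∈ ℤ/pℤ be nonzero with A₁ ≠ A₂; let L := {(a₁, a₂) ∈ ℤ² | a₁ • A₁ + a₂ • A₂ = 0 in ℤ/pℤ}, and let d* be the full-rank degree of L (the least d such that L contains two ℤ-linearly independent nonnegative elements of degree ≤ d). Then d* = ⌈√p⌉ + 1 if and only if either p = 3, or there exists a natural number d ≥ 4 such that p = d² − 3d + 1 and there is a unit u of ℤ/pℤ with {u·A₁, u·A₂} = {(1 : ℤ/pℤ), ((d² − 4d + 2 : ℕ) : ℤ/pℤ)} as two-element sets. -/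
/-- The lattice `{(a₁, a₂) ∈ ℤ² | a₁ • A₁ + a₂ • A₂ = 0}` in `ℤ/pℤ`. -/
def latChar (p : ℕ) (A₁ A₂ : ZMod p) : AddSubgroup (Fin 2 → ℤ) where
  carrier := {a | a 0 • A₁ + a 1 • A₂ = 0}
  zero_mem' := by simp
  add_mem' := by
    intro x y hx hy
    simp only [Set.mem_setOf_eq, Pi.add_apply, add_smul] at *
    rw [show x 0 • A₁ + y 0 • A₁ + (x 1 • A₂ + y 1 • A₂)
        = (x 0 • A₁ + x 1 • A₂) + (y 0 • A₁ + y 1 • A₂) by abel, hx, hy, add_zero]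
  neg_mem' := by
    intro x hx
    simp only [Set.mem_setOf_eq, Pi.neg_apply, neg_smul] at *
    rw [show -(x 0 • A₁) + -(x 1 • A₂) = -(x 0 • A₁ + x 1 • A₂) by abel, hx, neg_zero]

/-- The full-rank degree of a subgroup `L ≤ ℤ²`: the least `d` such that `L` contains two
`ℤ`-linearly independent nonnegative elements of degree `≤ d`. -/
noncomputable def fullRankDeg (L : AddSubgroup (Fin 2 → ℤ)) : ℕ :=
  sInf {d : ℕ | ∃ a b : Fin 2 → ℤ, a ∈ L ∧ b ∈ L ∧ LinearIndependent ℤ ![a, b] ∧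
    (∀ i, 0 ≤ a i) ∧ (∀ i, 0 ≤ b i) ∧ a 0 + a 1 ≤ (d : ℤ) ∧ b 0 + b 1 ≤ (d : ℤ)}

theorem linearIndependent_int_pair_iff_det_ne_zero (a b : Fin 2 → ℤ) :
    LinearIndependent ℤ ![a, b] ↔ a 0 * b 1 - a 1 * b 0 ≠ 0 := by
  rw [LinearIndependent.pair_iff]
  constructor
  · intro h hdet
    have h0 := h (b 0) (-a 0) (by ext i; fin_cases i <;> simp <;> linarith)
    have h1 := h (b 1) (-a 1) (by ext i; fin_cases i <;> simp <;> linarith)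
    have hb : b = 0 := by ext i; fin_cases i <;> simp [h0.1, h1.1]
    simpa using (h 0 1 (by simp [hb])).2
  · intro hdet s t hst
    have e0 : s * a 0 + t * b 0 = 0 := by simpa using congrFun hst 0
    have e1 : s * a 1 + t * b 1 = 0 := by simpa using congrFun hst 1
    constructor
    · exact (mul_eq_zero.mp (show s * (a 0 * b 1 - a 1 * b 0) = 0 by
        linear_combination b 1 * e0 - b 0 * e1)).resolve_right hdet
    · exact (mul_eq_zero.mp (show t * (a 0 * b 1 - a 1 * b 0) = 0 by
        linear_combination a 0 * e1 - a 1 * e0)).resolve_right hdet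

theorem mem_latChar {p : ℕ} {A₁ A₂ : ZMod p} {a : Fin 2 → ℤ} :
    a ∈ latChar p A₁ A₂ ↔ (a 0 : ZMod p) * A₁ + (a 1 : ZMod p) * A₂ = 0 := by
  change a 0 • A₁ + a 1 • A₂ = 0 ↔ _
  simp only [zsmul_eq_mul]

/-- A positively oriented pair of nonnegative lattice vectors of degree at most `d`; the
coordinates are `a = (x, e)` and `b = (f, y)`. -/
structure OrientedPair (p : ℕ) (A₁ A₂ : ZMod p) (d x e f y : ℤ) : Prop where
  x_nonneg : 0 ≤ x
  e_nonneg : 0 ≤ e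
  f_nonneg : 0 ≤ f
  y_nonneg : 0 ≤ y
  deg_left : x + e ≤ d
  deg_right : f + y ≤ d
  det_pos : 0 < x * y - e * f
  mem_left : (x : ZMod p) * A₁ + (e : ZMod p) * A₂ = 0
  mem_right : (f : ZMod p) * A₁ + (y : ZMod p) * A₂ = 0

theorem exists_indep_iff_exists_orientedPair {p : ℕ} {A₁ A₂ : ZMod p} {d : ℤ} :
    (∃ a b : Fin 2 → ℤ, a ∈ latChar p A₁ A₂ ∧ b ∈ latChar p A₁ A₂ ∧
      LinearIndependent ℤ ![a, b] ∧ (∀ i, 0 ≤ a i) ∧ (∀ i, 0 ≤ b i) ∧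
      a 0 + a 1 ≤ d ∧ b 0 + b 1 ≤ d) ↔ ∃ x e f y : ℤ, OrientedPair p A₁ A₂ d x e f y := by
  constructor
  · rintro ⟨a, b, ha, hb, hab, ha0, hb0, had, hbd⟩
    rw [linearIndependent_int_pair_iff_det_ne_zero] at hab
    rw [mem_latChar] at ha hb
    rcases lt_or_gt_of_ne hab with h | h
    · exact ⟨b 0, b 1, a 0, a 1, hb0 0, hb0 1, ha0 0, ha0 1, hbd, had, by linarith, hb, ha⟩
    · exact ⟨a 0, a 1, b 0, b 1, ha0 0, ha0 1, hb0 0, hb0 1, had, hbd, h, ha, hb⟩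
  · rintro ⟨x, e, f, y, h⟩
    refine ⟨![x, e], ![f, y], ?_, ?_, ?_, ?_, ?_, h.deg_left, h.deg_right⟩
    · exact mem_latChar.mpr h.mem_left
    · exact mem_latChar.mpr h.mem_right
    · exact (linearIndependent_int_pair_iff_det_ne_zero _ _).mpr h.det_pos.ne'
    · exact Fin.forall_fin_two.mpr ⟨h.x_nonneg, h.e_nonneg⟩
    · exact Fin.forall_fin_two.mpr ⟨h.f_nonneg, h.y_nonneg⟩

namespace OrientedPair

variable {p : ℕ} {A₁ A₂ : ZMod p} {d x e f y : ℤ}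

theorem dvd_det (h : OrientedPair p A₁ A₂ d x e f y) (hp : p.Prime) (h1 : A₁ ≠ 0) :
    (p : ℤ) ∣ x * y - e * f := by
  have := Fact.mk hp
  rw [← ZMod.intCast_zmod_eq_zero_iff_dvd]
  push_cast
  exact (mul_eq_zero.mp (show ((x : ZMod p) * y - e * f) * A₁ = 0 by
    linear_combination (y : ZMod p) * h.mem_left - (e : ZMod p) * h.mem_right)).resolve_right h1

/-- The off-diagonal coordinates are positive unless the degree is at least `p`. -/
theorem le_or_one_le (h : OrientedPair p A₁ A₂ d x e f y) (hp : p.Prime)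
    (h1 : A₁ ≠ 0) (h2 : A₂ ≠ 0) : (p : ℤ) ≤ d ∨ (1 ≤ e ∧ 1 ≤ f) := by
  have := Fact.mk hp
  obtain ⟨hx, he, hf, hy, hl, hr, hdet, ml, mr⟩ := h
  rcases he.eq_or_lt with rfl | he
  · left
    have hx0 : 0 < x := by
      rcases hx.eq_or_lt with rfl | hx
      · simp at hdet
      · exact hx
    have : (p : ℤ) ∣ x := by
      rw [← ZMod.intCast_zmod_eq_zero_iff_dvd]
      simpa [h1] using ml
    linarith [Int.le_of_dvd hx0 this]
  · rcases hf.eq_or_lt with rfl | hf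
    · left
      have hy0 : 0 < y := by
        rcases hy.eq_or_lt with rfl | hy
        · simp at hdet
        · exact hy
      have : (p : ℤ) ∣ y := by
        rw [← ZMod.intCast_zmod_eq_zero_iff_dvd]
        simpa [h2] using mr
      linarith [Int.le_of_dvd hy0 this]
    · exact Or.inr ⟨he, hf⟩

/-- No pair has degree at most `⌈√p⌉`. -/
theorem lt_degree (h : OrientedPair p A₁ A₂ d x e f y) (hp : p.Prime) (hp2 : p ≠ 2)
    (h1 : A₁ ≠ 0) (h2 : A₂ ≠ 0) {D : ℤ} (hD : 1 ≤ D) (hDp : (D - 1) ^ 2 < p) : D < d := by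
  by_contra! hd
  have hp3 : (3 : ℤ) ≤ p := by have := hp.two_le; omega
  have hdvd := Int.le_of_dvd h.det_pos (h.dvd_det hp h1)
  rcases h.le_or_one_le hp h1 h2 with hpd | ⟨he, hf⟩
  · nlinarith
  · obtain ⟨hx, -, -, hy, hl, hr, -, -, -⟩ := h
    have : x * y ≤ (D - 1) * (D - 1) := mul_le_mul (by linarith) (by linarith) hy (by linarith)
    nlinarith

/-- Classification of the pairs of degree at most `⌈√p⌉ + 1`. -/
theorem classify {D : ℤ} (h : OrientedPair p A₁ A₂ (D + 1) x e f y) (hp : p.Prime) (hp2 : p ≠ 2)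
    (h1 : A₁ ≠ 0) (h2 : A₂ ≠ 0) (hD : 1 ≤ D) (hDp : (D - 1) ^ 2 < p) :
    p = 3 ∨ ((p : ℤ) = D ^ 2 - D - 1 ∧ e = 1 ∧ f = 1 ∧
      ((x = D ∧ y = D - 1) ∨ (x = D - 1 ∧ y = D))) := by
  have hp3 : (3 : ℤ) ≤ p := by have := hp.two_le; omega
  have hpZ : Prime (p : ℤ) := Nat.prime_iff_prime_int.mp hp
  rcases h.le_or_one_le hp h1 h2 with hpd | ⟨he, hf⟩
  · left
    have : D ≤ 2 := by nlinarith
    omega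
  obtain ⟨k, hk⟩ := h.dvd_det hp h1
  obtain ⟨hx, -, -, hy, hl, hr, hdet, -, -⟩ := h
  have hxy : x * y ≤ D * D := mul_le_mul (by linarith) (by linarith) hy (by linarith)
  have hef : 1 ≤ e * f := by nlinarith
  have hk0 : 0 < k := by
    by_contra! hk0
    nlinarith
  rcases (show 1 ≤ k from hk0).eq_or_lt with rfl | hk2
  swap
  · left
    have h2p : 2 * (p : ℤ) ≤ D * D - 1 := by nlinarith
    have : D ≤ 2 := by nlinarith
    nlinarith
  have bound : ∀ u v : ℤ, x ≤ u → y ≤ v → 0 ≤ u → x * y ≤ u * v := fun u v hu hv hu0 =>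
    mul_le_mul hu hv hy hu0
  have hD2 : 2 ≤ D := by nlinarith
  -- an integer factorization of `p` has a unit factor
  have unit_factor : ∀ u v : ℤ, (p : ℤ) = u * v → 0 ≤ u → 1 < v → u = 1 := by
    intro u v huv hu hv
    rcases hpZ.irreducible.isUnit_or_isUnit huv with h | h
    · rcases Int.isUnit_iff.mp h with h | h <;> omega
    · rcases Int.isUnit_iff.mp h with h | h <;> omega
  have p_eq : (p : ℤ) = x * y - e * f := by linarith
  rcases he.eq_or_lt with rfl | he2 <;> rcases hf.eq_or_lt with rfl | hf2
  · by_cases hxD : x = D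
    · by_cases hyD : y = D
      · left
        subst hxD
        subst hyD
        have := unit_factor (y - 1) (y + 1) (by rw [p_eq]; ring) (by linarith) (by linarith)
        obtain rfl : y = 2 := by linarith
        omega
      by_cases hyD' : y = D - 1
      · right
        subst hxD
        subst hyD'
        exact ⟨by rw [p_eq]; ring, rfl, rfl, Or.inl ⟨rfl, rfl⟩⟩
      · have := bound D (D - 2) (by omega) (by omega) (by omega)
        nlinarith
    · by_cases hyD : y = D
      · by_cases hxD' : x = D - 1
        · right
          subst hyD
          subst hxD'
          exact ⟨by rw [p_eq]; ring, rfl, rfl, Or.inr ⟨rfl, rfl⟩⟩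
        · have := bound (D - 2) D (by omega) (by omega) (by omega)
          nlinarith
      · have := bound (D - 1) (D - 1) (by omega) (by omega) (by omega)
        nlinarith
  · exfalso
    by_cases hD' : f = 2 ∧ y = D - 1 ∧ x = D
    · obtain ⟨rfl, rfl, rfl⟩ := hD'
      have := unit_factor (x - 2) (x + 1) (by rw [p_eq]; ring) (by linarith) (by linarith)
      obtain rfl : x = 3 := by linarith
      have : p = 2 * 2 := by zify; linarith
      exact Nat.not_prime_mul (by norm_num) (by norm_num) (this ▸ hp)
    · rcases (show y ≤ D - 2 ∨ x ≤ D - 1 by omega) with hc | hc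
      · have := bound D (D - 2) (by omega) (by omega) (by omega)
        nlinarith
      · have := bound (D - 1) (D - 1) (by omega) (by omega) (by omega)
        nlinarith
  · exfalso
    by_cases hD' : e = 2 ∧ x = D - 1 ∧ y = D
    · obtain ⟨rfl, rfl, rfl⟩ := hD'
      have := unit_factor (y - 2) (y + 1) (by rw [p_eq]; ring) (by linarith) (by linarith)
      obtain rfl : y = 3 := by linarith
      have : p = 2 * 2 := by zify; linarith
      exact Nat.not_prime_mul (by norm_num) (by norm_num) (this ▸ hp)
    · rcases (show x ≤ D - 2 ∨ y ≤ D - 1 by omega) with hc | hc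
      · have := bound (D - 2) D (by omega) (by omega) (by omega)
        nlinarith
      · have := bound (D - 1) (D - 1) (by omega) (by omega) (by omega)
        nlinarith
  · exfalso
    have := bound (D - 1) (D - 1) (by omega) (by omega) (by omega)
    nlinarith

end OrientedPair

theorem Nat.ceil_sqrt_pred_sq_lt {p : ℕ} (hp : 0 < p) :
    1 ≤ (⌈√(p : ℝ)⌉₊ : ℤ) ∧ ((⌈√(p : ℝ)⌉₊ : ℤ) - 1) ^ 2 < p := by
  have hs : 0 < √(p : ℝ) := Real.sqrt_pos.mpr (by exact_mod_cast hp)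
  have h1 : 1 ≤ ⌈√(p : ℝ)⌉₊ := Nat.ceil_pos.mpr hs
  refine ⟨by exact_mod_cast h1, ?_⟩
  have h2 := Nat.ceil_lt_add_one hs.le
  have h3 : (1 : ℝ) ≤ ⌈√(p : ℝ)⌉₊ := by exact_mod_cast h1
  have h4 : ((⌈√(p : ℝ)⌉₊ : ℝ) - 1) ^ 2 < p := by
    rw [← Real.lt_sqrt (by linarith)]
    linarith
  exact_mod_cast h4

theorem Nat.ceil_sqrt_eq {p n : ℕ} (h1 : n ^ 2 < p) (h2 : p ≤ (n + 1) ^ 2) :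
    ⌈√(p : ℝ)⌉₊ = n + 1 := by
  rw [Nat.ceil_eq_iff (by omega)]
  constructor
  · rw [Nat.add_sub_cancel, Real.lt_sqrt (by positivity)]
    exact_mod_cast h1
  · rw [Real.sqrt_le_left (by positivity)]
    exact_mod_cast h2

theorem ZMod.three_add_eq_zero : ∀ a b : ZMod 3, a ≠ 0 → b ≠ 0 → a ≠ b → a + b = 0 := by
  decide

theorem fullRankDeg_latChar_eq_iff {p : ℕ} (hp : p.Prime) (hp2 : p ≠ 2) {A₁ A₂ : ZMod p}
    (h1 : A₁ ≠ 0) (h2 : A₂ ≠ 0) :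
    fullRankDeg (latChar p A₁ A₂) = ⌈√(p : ℝ)⌉₊ + 1 ↔
      ∃ x e f y : ℤ, OrientedPair p A₁ A₂ (⌈√(p : ℝ)⌉₊ + 1) x e f y := by
  unfold fullRankDeg
  simp only [exists_indep_iff_exists_orientedPair]
  set S := {d : ℕ | ∃ x e f y : ℤ, OrientedPair p A₁ A₂ d x e f y} with hS
  constructor
  · intro h
    have hmem : sInf S ∈ S := Nat.sInf_mem (Nat.nonempty_of_pos_sInf (by omega))
    rw [h] at hmem
    simpa [hS] using hmem
  · intro h
    have hmem : ⌈√(p : ℝ)⌉₊ + 1 ∈ S := by simpa [hS] using h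
    refine le_antisymm (Nat.sInf_le hmem) (le_csInf ⟨_, hmem⟩ ?_)
    rintro d ⟨x, e, f, y, hd⟩
    obtain ⟨hD, hDp⟩ := Nat.ceil_sqrt_pred_sq_lt hp.pos
    have := hd.lt_degree hp hp2 h1 h2 hD hDp
    omega

/-- Let `p` be an odd prime and `A₁, A₂ ∈ ℤ/pℤ` nonzero and distinct, and
let `d*` be the full-rank degree of `L = {(a₁,a₂) | a₁ • A₁ + a₂ • A₂ = 0}`. Then
`d* = ⌈√p⌉ + 1` iff either `p = 3`, or `p = d² − 3d + 1` for some `d ≥ 4` and, up to a unit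
of `ℤ/pℤ`, `{A₁, A₂} = {1, d² − 4d + 2}`. -/
theorem stmt_14 (p : ℕ) (hp : p.Prime) (hp2 : p ≠ 2) (A₁ A₂ : ZMod p)
    (h1 : A₁ ≠ 0) (h2 : A₂ ≠ 0) (hne : A₁ ≠ A₂) :
    fullRankDeg (latChar p A₁ A₂) = ⌈Real.sqrt p⌉₊ + 1 ↔
      p = 3 ∨ ∃ d : ℕ, 4 ≤ d ∧ p = d ^ 2 - 3 * d + 1 ∧
        ∃ u : (ZMod p)ˣ, ({(u : ZMod p) * A₁, (u : ZMod p) * A₂} : Set (ZMod p)) =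
          {1, ((d ^ 2 - 4 * d + 2 : ℕ) : ZMod p)} := by
  have := Fact.mk hp
  have hp3 : (3 : ℤ) ≤ p := by have := hp.two_le; omega
  rw [fullRankDeg_latChar_eq_iff hp hp2 h1 h2]
  -- for `d = k + 4`, the two residues in the statement
  have sub_p : ∀ k : ℕ, (k + 4) ^ 2 - 3 * (k + 4) + 1 = k ^ 2 + 5 * k + 5 := by
    intro k
    have : (k + 4) ^ 2 = k ^ 2 + 5 * k + 4 + 3 * (k + 4) := by ring
    omega
  have sub_c : ∀ k : ℕ, (k + 4) ^ 2 - 4 * (k + 4) + 2 = k ^ 2 + 4 * k + 2 := by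
    intro k
    have : (k + 4) ^ 2 = k ^ 2 + 4 * k + 4 * (k + 4) := by ring
    omega
  have cast_p : ∀ k : ℕ, p = k ^ 2 + 5 * k + 5 → (k : ZMod p) ^ 2 + 5 * k + 5 = 0 := by
    intro k hk
    have := congrArg (Nat.cast : ℕ → ZMod p) hk
    rw [ZMod.natCast_self] at this
    exact_mod_cast this.symm
  constructor
  · rintro ⟨x, e, f, y, h⟩
    obtain ⟨hD, hDp⟩ := Nat.ceil_sqrt_pred_sq_lt hp.pos
    rcases h.classify hp hp2 h1 h2 hD hDp with h3 | ⟨hpD, rfl, rfl, hxy⟩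
    · exact Or.inl h3
    right
    generalize ⌈√(p : ℝ)⌉₊ = D at *
    have hD3 : 3 ≤ D := by
      by_contra! hD3
      interval_cases D <;> simp at hpD <;> omega
    obtain ⟨k, rfl⟩ := Nat.exists_eq_add_of_le' hD3
    have hpk : p = k ^ 2 + 5 * k + 5 := by
      zify
      rw [hpD]
      push_cast
      ring
    have hck := cast_p k hpk
    have ml := h.mem_left
    have mr := h.mem_right
    refine ⟨k + 4, by omega, by rw [sub_p, hpk], ?_⟩
    rw [sub_c]
    rcases hxy with ⟨rfl, rfl⟩ | ⟨rfl, rfl⟩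
    · refine ⟨(Units.mk0 A₁ h1)⁻¹, ?_⟩
      push_cast at ml ⊢
      have : A₂ = (k ^ 2 + 4 * k + 2) * A₁ := by linear_combination ml - A₁ * hck
      simp only [Units.val_mk0]
      rw [this, inv_mul_cancel₀ h1, mul_comm A₁⁻¹, mul_inv_cancel_right₀ h1]
    · refine ⟨(Units.mk0 A₂ h2)⁻¹, ?_⟩
      push_cast at mr ⊢
      have : A₁ = (k ^ 2 + 4 * k + 2) * A₂ := by linear_combination mr - A₂ * hck
      simp only [Units.val_mk0]
      rw [this, inv_mul_cancel₀ h2, mul_comm A₂⁻¹, mul_inv_cancel_right₀ h2, Set.pair_comm]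
  · rintro (rfl | ⟨d, hd, hpd, u, hu⟩)
    · rw [Nat.ceil_sqrt_eq (n := 1) (by norm_num) (by norm_num)]
      have := ZMod.three_add_eq_zero A₁ A₂ h1 h2 hne
      refine ⟨3, 0, 1, 1, by norm_num, by norm_num, by norm_num, by norm_num, by norm_num,
        by norm_num, by norm_num, ?_, by simpa using this⟩
      rw [show ((3 : ℤ) : ZMod 3) = 0 from rfl]
      simp
    obtain ⟨k, rfl⟩ := Nat.exists_eq_add_of_le' hd
    rw [sub_p] at hpd
    rw [sub_c] at hu
    have hck := cast_p k hpd
    rw [Nat.ceil_sqrt_eq (n := k + 2) (by rw [hpd]; nlinarith) (by rw [hpd]; nlinarith)]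
    have hu0 : (u : ZMod p) ≠ 0 := u.ne_zero
    rcases Set.pair_eq_pair_iff.mp hu with ⟨e1, e2⟩ | ⟨e1, e2⟩
    · have key : A₂ = -(k + 3) * A₁ := by
        apply mul_left_cancel₀ hu0
        push_cast at e2
        linear_combination e2 + (k + 3) * e1 + hck
      refine ⟨k + 3, 1, 1, k + 2, by positivity, by norm_num, by norm_num, by positivity,
        by push_cast; linarith, by push_cast; linarith, by nlinarith, ?_, ?_⟩
      · push_cast
        linear_combination key
      · push_cast
        linear_combination (k + 2) * key - A₁ * hck
    · have key : A₁ = -(k + 3) * A₂ := by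
        apply mul_left_cancel₀ hu0
        push_cast at e1
        linear_combination e1 + (k + 3) * e2 + hck
      refine ⟨k + 2, 1, 1, k + 3, by positivity, by norm_num, by norm_num, by positivity,
        by push_cast; linarith, by push_cast; linarith, by nlinarith, ?_, ?_⟩
      · push_cast
        linear_combination (k + 2) * key - A₂ * hck
      · push_cast
        linear_combination key
end
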